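/- There is no map Q : ℂ → M₂(ℂ) that is complex differentiable on all of ℂ, has bounded range, and satisfies for every λ ∈ ℂ that Q(λ) is an idempotent matrix (Q(λ)² = Q(λ)) whose range (column space) equals the one-dimensional subspace ℂ·(1, λ) of ℂ². -/

import Mathlib

attribute [local instance] Matrix.normedAddCommGroup Matrix.normedSpace

/-- There is no map `Q : ℂ → M₂(ℂ)` that is complex differentiable on all
of `ℂ`, has bounded range, and satisfies for every `λ ∈ ℂ` that `Q(λ)` is an idempotent
matrix whose range (column space) equals the one-dimensional subspace `ℂ·(1, λ)`. -/
theorem stmt_15 :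
    ¬ ∃ Q : ℂ → Matrix (Fin 2) (Fin 2) ℂ,
        Differentiable ℂ Q ∧
        (∃ C : ℝ, ∀ z : ℂ, ‖Q z‖ ≤ C) ∧
        ∀ z : ℂ, Q z * Q z = Q z ∧
          LinearMap.range (Matrix.mulVecLin (Q z)) = Submodule.span ℂ {![1, z]} := by
  rintro ⟨Q, hd, ⟨C, hC⟩, h⟩
  have hb : Bornology.IsBounded (Set.range Q) := by
    refine isBounded_iff_forall_norm_le.2 ⟨C, ?_⟩
    rintro _ ⟨z, rfl⟩
    exact hC z
  have e : Q 0 = Q 1 := hd.apply_eq_apply_of_bounded hb 0 1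
  have h0 := (h 0).2
  rw [e, (h 1).2] at h0
  have hm : (![1, 1] : Fin 2 → ℂ) ∈ Submodule.span ℂ {(![1, 0] : Fin 2 → ℂ)} := by
    rw [← h0]
    exact Submodule.mem_span_singleton_self _
  obtain ⟨a, ha⟩ := Submodule.mem_span_singleton.1 hm
  have := congrFun ha 1
  simp at this
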